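/- Fix $n \in \mathbb{N}$ with $n \ge 2$, and let $u, v$ be as above. For $f \in D(J_n^*)$ set $\Gamma_1 f = [f,v]_\infty$ and $\Gamma_2 f = [f,u]_\infty$. Then: (i) for every $h \in \mathbb{R}$, the restriction of $J_n^*$ to the domain $\{ f \in D(J_n^*) : \Gamma_1 f - h\, \Gamma_2 f = 0 \}$ is a self-adjoint operator; (ii) the restriction of $J_n^*$ to the domain $\{ f \in D(J_n^*) : \Gamma_2 f = 0 \}$ is a self-adjoint operator; and (iii) every self-adjoint extension of $J_n$ is equal to one of the operators in (i) or (ii). -/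

import Mathlib

noncomputable section

open scoped ComplexConjugate
open Filter

/-- The Hilbert space `ℓ²(ℕ; ℂ)`. -/
abbrev H1 : Type := lp (fun _ : ℕ => ℂ) 2

/-- `β(m,n) = (1/2)·√(m+1)·(1-m-n)`. -/
def beta (m n : ℕ) : ℝ := (1 / 2) * Real.sqrt ((m : ℝ) + 1) * (1 - (m : ℝ) - (n : ℝ))

/-- The formal Jacobi action in the row `n`:
`(J_n u)(m) = β(m,n) u(m+1) + β(m-1,n) u(m-1)`, with the convention `β(-1,n) = 0`. -/
def jacobiActRow (n : ℕ) (u : ℕ → ℂ) : ℕ → ℂ := fun m =>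
  (beta m n : ℂ) * u (m + 1) +
    (if m = 0 then 0 else (beta (m - 1) n : ℂ) * u (m - 1))

/-- The boundary bracket sequence `M ↦ β(M,n)(f(M)·conj w(M+1) - f(M+1)·conj w(M))`
for `f : ℓ²` and a real sequence `w`; its limit as `M → ∞` is `[f,w]_∞`. -/
def brk (n : ℕ) (f : H1) (w : ℕ → ℝ) : ℕ → ℂ := fun M =>
  (beta M n : ℂ) * (f M * conj ((w (M + 1) : ℂ)) - f (M + 1) * conj ((w M : ℂ)))

open scoped InnerProductSpace LinearPMap

namespace LinearPMap

variable {E : Type*} [NormedAddCommGroup E] [InnerProductSpace ℂ E] [CompleteSpace E]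
  {T A : E →ₗ.[ℂ] E}

theorem adjoint_le_adjoint_of_le (hT : Dense (T.domain : Set E)) (h : T ≤ A) : A† ≤ T† := by
  have hA : Dense (A.domain : Set E) := hT.mono h.1
  refine IsFormalAdjoint.le_adjoint hT fun x y => ?_
  have hxy : T x = A ⟨x, h.1 x.2⟩ := h.2 rfl
  rw [hxy]
  exact (adjoint_isFormalAdjoint hA).symm ⟨x, h.1 x.2⟩ y

theorem le_adjoint_of_isSelfAdjoint (hT : Dense (T.domain : Set E)) (hA : IsSelfAdjoint A)
    (hTA : T ≤ A) : A ≤ T† := by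
  have := adjoint_le_adjoint_of_le hT hTA
  rwa [isSelfAdjoint_def.1 hA] at this

/-- A pair of functionals on the domain of `T†` that expresses the boundary form of `T†`
and maps onto `ℂ × ℂ`. -/
structure IsBoundaryPair (T : E →ₗ.[ℂ] E) (Γ₁ Γ₂ : T†.domain →ₗ[ℂ] ℂ) : Prop where
  green : ∀ f g : T†.domain, ⟪(g : E), T† f⟫_ℂ - ⟪T† g, (f : E)⟫_ℂ =
    Γ₁ f * conj (Γ₂ g) - Γ₂ f * conj (Γ₁ g)
  surj : ∀ a b : ℂ, ∃ f, Γ₁ f = a ∧ Γ₂ f = b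

namespace IsBoundaryPair

variable {Γ₁ Γ₂ : T†.domain →ₗ[ℂ] ℂ}

theorem eq_zero_of_mem_domain (hΓ : IsBoundaryPair T Γ₁ Γ₂) (hT : Dense (T.domain : Set E))
    (hTT : T ≤ T†) {f : T†.domain} (hf : (f : E) ∈ T.domain) : Γ₁ f = 0 ∧ Γ₂ f = 0 := by
  have key : ∀ g, Γ₁ f * conj (Γ₂ g) - Γ₂ f * conj (Γ₁ g) = 0 := fun g => by
    rw [← hΓ.green, ← hTT.2 (x := ⟨f, hf⟩) (y := f) rfl, sub_eq_zero]
    exact (adjoint_isFormalAdjoint hT g ⟨f, hf⟩).symm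
  obtain ⟨g, hg₁, hg₂⟩ := hΓ.surj 0 1
  obtain ⟨k, hk₁, hk₂⟩ := hΓ.surj 1 0
  have h₁ := key g
  have h₂ := key k
  simp_all

theorem mem_adjoint_domain_iff (hΓ : IsBoundaryPair T Γ₁ Γ₂) (hT : Dense (T.domain : Set E))
    (hTA : T ≤ A) (hAT : A ≤ T†) (g : T†.domain) :
    (g : E) ∈ A†.domain ↔
      ∀ f : T†.domain, (f : E) ∈ A.domain → Γ₁ f * conj (Γ₂ g) = Γ₂ f * conj (Γ₁ g) := by
  have hA : Dense (A.domain : Set E) := hT.mono hTA.1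
  constructor
  · intro hg f hf
    rw [← sub_eq_zero, ← hΓ.green, ← hAT.2 (x := ⟨f, hf⟩) (y := f) rfl,
      ← (adjoint_le_adjoint_of_le hT hTA).2 (x := ⟨g, hg⟩) (y := g) rfl, sub_eq_zero]
    exact (adjoint_isFormalAdjoint hA ⟨g, hg⟩ ⟨f, hf⟩).symm
  · intro h
    refine mem_adjoint_domain_of_exists _ ⟨T† g, fun f => ?_⟩
    have hf := hΓ.green ⟨f, hAT.1 f.2⟩ g
    rw [h _ f.2, sub_self, sub_eq_zero, ← hAT.2 (x := f) rfl] at hf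
    exact hf.symm

theorem isSelfAdjoint_iff (hΓ : IsBoundaryPair T Γ₁ Γ₂) (hT : Dense (T.domain : Set E))
    (hTA : T ≤ A) (hAT : A ≤ T†) :
    IsSelfAdjoint A ↔ ∀ g : T†.domain, (g : E) ∈ A.domain ↔
      ∀ f : T†.domain, (f : E) ∈ A.domain → Γ₁ f * conj (Γ₂ g) = Γ₂ f * conj (Γ₁ g) := by
  have hle := adjoint_le_adjoint_of_le hT hTA
  rw [isSelfAdjoint_def]
  constructor
  · intro h g
    rw [← hΓ.mem_adjoint_domain_iff hT hTA hAT, h]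
  · intro h
    refine LinearPMap.ext (Submodule.ext fun g => ?_) fun g hg hg' => ?_
    · by_cases hg : g ∈ T†.domain
      · rw [h ⟨g, hg⟩, ← hΓ.mem_adjoint_domain_iff hT hTA hAT]
      · exact iff_of_false (fun h' => hg (hle.1 h')) fun h' => hg (hAT.1 h')
    · rw [hle.2 (x := ⟨g, hg⟩) (y := ⟨g, hle.1 hg⟩) rfl,
        hAT.2 (x := ⟨g, hg'⟩) (y := ⟨g, hle.1 hg⟩) rfl]

theorem isSelfAdjoint_of_boundary_eq (hΓ : IsBoundaryPair T Γ₁ Γ₂)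
    (hT : Dense (T.domain : Set E)) (hTT : T ≤ T†) (hAT : A ≤ T†) (h : ℝ)
    (hA : ∀ f : T†.domain, (f : E) ∈ A.domain ↔ Γ₁ f = h * Γ₂ f) : IsSelfAdjoint A := by
  have hTA : T ≤ A := ⟨fun f hf => (hA ⟨f, hTT.1 hf⟩).2 (by
      simp [hΓ.eq_zero_of_mem_domain hT hTT (f := ⟨f, hTT.1 hf⟩) hf]), fun x y hxy => by
    rw [hTT.2 (y := ⟨x, hTT.1 x.2⟩) rfl, hAT.2 (y := ⟨x, hTT.1 x.2⟩) hxy.symm]⟩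
  rw [hΓ.isSelfAdjoint_iff hT hTA hAT]
  refine fun g => ⟨fun hg f hf => ?_, fun hg => ?_⟩
  · rw [(hA f).1 hf, (hA g).1 hg, map_mul, Complex.conj_ofReal]
    ring
  · obtain ⟨f, hf₁, hf₂⟩ := hΓ.surj h 1
    have hfg := hg f ((hA f).2 (by simp [hf₁, hf₂]))
    rw [hf₁, hf₂] at hfg
    rw [hA, ← Complex.conj_conj (Γ₁ g), ← one_mul (conj (Γ₁ g)), ← hfg]
    simp

theorem isSelfAdjoint_of_boundary_eq_zero (hΓ : IsBoundaryPair T Γ₁ Γ₂)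
    (hT : Dense (T.domain : Set E)) (hTT : T ≤ T†) (hAT : A ≤ T†)
    (hA : ∀ f : T†.domain, (f : E) ∈ A.domain ↔ Γ₂ f = 0) : IsSelfAdjoint A := by
  have hTA : T ≤ A := ⟨fun f hf => (hA ⟨f, hTT.1 hf⟩).2
      (hΓ.eq_zero_of_mem_domain hT hTT (f := ⟨f, hTT.1 hf⟩) hf).2, fun x y hxy => by
    rw [hTT.2 (y := ⟨x, hTT.1 x.2⟩) rfl, hAT.2 (y := ⟨x, hTT.1 x.2⟩) hxy.symm]⟩
  rw [hΓ.isSelfAdjoint_iff hT hTA hAT]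
  refine fun g => ⟨fun hg f hf => ?_, fun hg => ?_⟩
  · simp [(hA f).1 hf, (hA g).1 hg]
  · obtain ⟨f, hf₁, hf₂⟩ := hΓ.surj 1 0
    have hfg := hg f ((hA f).2 hf₂)
    rw [hA]
    simpa [hf₁, hf₂] using hfg

theorem boundary_eq_of_isSelfAdjoint (hΓ : IsBoundaryPair T Γ₁ Γ₂)
    (hT : Dense (T.domain : Set E)) (hA : IsSelfAdjoint A) (hTA : T ≤ A) :
    (∃ h : ℝ, ∀ f : T†.domain, (f : E) ∈ A.domain ↔ Γ₁ f = h * Γ₂ f) ∨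
      ∀ f : T†.domain, (f : E) ∈ A.domain ↔ Γ₂ f = 0 := by
  have hAT := le_adjoint_of_isSelfAdjoint hT hA hTA
  have key := (hΓ.isSelfAdjoint_iff hT hTA hAT).1 hA
  by_cases h0 : ∀ f : T†.domain, (f : E) ∈ A.domain → Γ₂ f = 0
  · refine Or.inr fun g => ⟨h0 g, fun hg => (key g).2 fun f hf => ?_⟩
    simp [hg, h0 f hf]
  · push Not at h0
    obtain ⟨k, hkA, hk⟩ := h0
    have hkk := (key k).1 hkA k hkA
    have hk' : conj (Γ₂ k) ≠ 0 := by simpa using hk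
    have hreal : conj (Γ₁ k / Γ₂ k) = Γ₁ k / Γ₂ k := by
      rw [map_div₀, div_eq_div_iff hk' hk]
      linear_combination -hkk
    obtain ⟨h, hh⟩ := Complex.conj_eq_iff_real.1 hreal
    have hk₁ : Γ₁ k = h * Γ₂ k := by rw [← hh, div_mul_cancel₀ _ hk]
    have himp : ∀ g : T†.domain, (g : E) ∈ A.domain → Γ₁ g = h * Γ₂ g := fun g hg => by
      have hgk := (key g).1 hg k hkA
      rw [hk₁] at hgk
      have : conj (Γ₁ g) = h * conj (Γ₂ g) := mul_left_cancel₀ hk (by linear_combination -hgk)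
      rw [← Complex.conj_conj (Γ₁ g), this]
      simp
    refine Or.inl ⟨h, fun g => ⟨himp g, fun hg => (key g).2 fun f hf => ?_⟩⟩
    rw [himp f hf, hg, map_mul, Complex.conj_ofReal]
    ring

end IsBoundaryPair

/-- The functional `f ↦ ⟪T† w, f⟫ - ⟪w, T† f⟫` on the domain of `T†`. -/
def boundaryFunctional (T : E →ₗ.[ℂ] E) (w : T†.domain) : T†.domain →ₗ[ℂ] ℂ :=
  (innerₛₗ ℂ (T† w)).comp T†.domain.subtype - (innerₛₗ ℂ (w : E)).comp T†.toFun

theorem boundaryFunctional_apply (T : E →ₗ.[ℂ] E) (w f : T†.domain) :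
    boundaryFunctional T w f = ⟪T† w, (f : E)⟫_ℂ - ⟪(w : E), T† f⟫_ℂ := rfl

end LinearPMap

section JacobiMatrix

open LinearPMap

theorem beta_ne_zero {n : ℕ} (hn : 2 ≤ n) (m : ℕ) : beta m n ≠ 0 := by
  have hn' : (2 : ℝ) ≤ n := by exact_mod_cast hn
  have hm : (0 : ℝ) ≤ m := m.cast_nonneg
  have : 0 < √((m : ℝ) + 1) := Real.sqrt_pos.2 (by linarith)
  unfold beta
  refine mul_ne_zero (by positivity) (by linarith)

/-- The Wronskian `β(M,n)(f(M)·conj g(M+1) - f(M+1)·conj g(M))`. -/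
def wronskian (n : ℕ) (f g : ℕ → ℂ) (M : ℕ) : ℂ :=
  (beta M n : ℂ) * (f M * conj (g (M + 1)) - f (M + 1) * conj (g M))

theorem sum_range_jacobiActRow (n : ℕ) (f g : ℕ → ℂ) (M : ℕ) :
    ∑ k ∈ Finset.range (M + 1),
      (conj (jacobiActRow n g k) * f k - conj (g k) * jacobiActRow n f k) = wronskian n f g M := by
  induction M with
  | zero => simp [jacobiActRow, wronskian]; ring
  | succ M ih =>
    rw [Finset.sum_range_succ, ih]
    simp [jacobiActRow, wronskian]
    ring

theorem wronskian_plucker {n M : ℕ} {u v : ℕ → ℝ} (f g : ℕ → ℂ)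
    (huv : wronskian n (fun m => u m) (fun m => v m) M = 1) :
    wronskian n f g M =
      wronskian n f (fun m => u m) M * conj (wronskian n g (fun m => v m) M) -
        wronskian n f (fun m => v m) M * conj (wronskian n g (fun m => u m) M) := by
  rw [← mul_one (wronskian n f g M), ← huv]
  simp [wronskian]
  ring

theorem wronskian_eq_one {n : ℕ} (hn : 2 ≤ n) {u v : ℕ → ℝ}
    (hurec : ∀ m : ℕ, 1 ≤ m → beta (m - 1) n * u (m - 1) + beta m n * u (m + 1) = 0)
    (hu0 : u 0 = 1)
    (hvrec : ∀ m : ℕ, 1 ≤ m → beta (m - 1) n * v (m - 1) + beta m n * v (m + 1) = 0)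
    (hv0 : v 0 = 0) (hv1 : v 1 = 1 / beta 0 n) (M : ℕ) :
    wronskian n (fun m => u m) (fun m => v m) M = 1 := by
  have key : beta M n * (u M * v (M + 1) - u (M + 1) * v M) = 1 := by
    induction M with
    | zero => simp [hu0, hv0, hv1, beta_ne_zero hn]
    | succ M ih =>
      have h₁ := hurec (M + 1) (by omega)
      have h₂ := hvrec (M + 1) (by omega)
      simp only [Nat.add_sub_cancel] at h₁ h₂
      linear_combination ih + u (M + 1) * h₂ - v (M + 1) * h₁
  simp only [wronskian, Complex.conj_ofReal]
  exact_mod_cast key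

theorem sq_le_telescope {n : ℕ} (hn : 2 ≤ n) {y : ℕ → ℝ} {m : ℕ}
    (h : beta m n * y m + beta (m + 1) n * y (m + 2) = 0) :
    y m ^ 2 ≤ (m + n) * y m ^ 2 - (m + 2 + n) * y (m + 2) ^ 2 := by
  have hn' : (2 : ℝ) ≤ n := by exact_mod_cast hn
  have hm : (0 : ℝ) ≤ m := m.cast_nonneg
  have hs₁ : √((m : ℝ) + 1) ^ 2 = m + 1 := Real.sq_sqrt (by linarith)
  have hs₂ : √((m : ℝ) + 1 + 1) ^ 2 = m + 2 := by rw [Real.sq_sqrt (by linarith)]; ring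
  have hsq : (m + 2 : ℝ) * (m + n) ^ 2 * y (m + 2) ^ 2
      = (m + 1) * (m + n - 1) ^ 2 * y m ^ 2 := by
    have h' : beta m n ^ 2 * y m ^ 2 = beta (m + 1) n ^ 2 * y (m + 2) ^ 2 := by
      linear_combination (beta m n * y m - beta (m + 1) n * y (m + 2)) * h
    simp only [beta, mul_pow, Nat.cast_add, Nat.cast_one, hs₁, hs₂] at h'
    linear_combination -4 * h'
  have hpos : (0 : ℝ) < (m + 2) * (m + n) ^ 2 := by positivity
  have hfac : (m + 2 + n : ℝ) * ((m + 1) * (m + n - 1) ^ 2) ≤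
      (m + n - 1) * ((m + 2) * (m + n) ^ 2) := by
    have hk : (m + n - 2 : ℝ) * (m + 1) ≤ (m + n) ^ 2 := by nlinarith
    have h1 : (0 : ℝ) ≤ m + n - 1 := by linarith
    linear_combination mul_le_mul_of_nonneg_left hk h1
  have hmul := mul_le_mul_of_nonneg_right hfac (sq_nonneg (y m))
  refine le_of_mul_le_mul_left ?_ hpos
  linear_combination hmul + (m + 2 + n) * hsq

theorem memℓp_of_recurrence {n : ℕ} (hn : 2 ≤ n) {y : ℕ → ℝ}
    (hrec : ∀ m : ℕ, 1 ≤ m → beta (m - 1) n * y (m - 1) + beta m n * y (m + 1) = 0) :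
    Memℓp (fun m => (y m : ℂ)) 2 := by
  have hbound : ∀ M, ∑ m ∈ Finset.range M, y m ^ 2 ≤
      n * y 0 ^ 2 + (n + 1) * y 1 ^ 2 - (M + n) * y M ^ 2 - (M + 1 + n) * y (M + 1) ^ 2 := by
    intro M
    induction M with
    | zero => simp; linarith
    | succ M ih =>
      rw [Finset.sum_range_succ]
      have := sq_le_telescope hn (hrec (M + 1) (by omega))
      simp only [Nat.add_sub_cancel, show M + 1 + 1 = M + 2 from rfl] at this ⊢
      push_cast
      linarith
  have hsum : Summable fun m => y m ^ 2 := by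
    refine summable_of_sum_range_le (c := n * y 0 ^ 2 + (n + 1) * y 1 ^ 2)
      (fun m => sq_nonneg _) fun M => (hbound M).trans ?_
    have h₁ : 0 ≤ ((M : ℝ) + n) * y M ^ 2 := by positivity
    have h₂ : 0 ≤ ((M : ℝ) + 1 + n) * y (M + 1) ^ 2 := by positivity
    linarith
  refine memℓp_gen ?_
  simpa using hsum

variable {n : ℕ} {J : H1 →ₗ.[ℂ] H1}

theorem single_mem_domain (hdom : ∀ w : H1, w ∈ J.domain ↔ {m : ℕ | w m ≠ 0}.Finite)
    (m : ℕ) (a : ℂ) : lp.single 2 m a ∈ J.domain := by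
  refine (hdom _).2 ((Set.finite_singleton m).subset fun k hk => ?_)
  by_contra hkm
  exact hk (lp.single_apply_ne (E := fun _ : ℕ => ℂ) 2 m a hkm)

theorem dense_domain_of_finite_support
    (hdom : ∀ w : H1, w ∈ J.domain ↔ {m : ℕ | w m ≠ 0}.Finite) :
    Dense (J.domain : Set H1) := by
  intro f
  refine mem_closure_of_tendsto (lp.hasSum_single ENNReal.ofNat_ne_top f) (.of_forall fun s => ?_)
  exact J.domain.sum_mem fun i _ => single_mem_domain hdom i (f i)

/-- Green's formula between a sequence in the domain of `J` and an arbitrary sequence. -/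
theorem tendsto_sum_jacobiActRow
    (hdom : ∀ w : H1, w ∈ J.domain ↔ {m : ℕ | w m ≠ 0}.Finite)
    (hact : ∀ w : J.domain, ∀ m : ℕ, (J w : H1) m = jacobiActRow n (⇑(w : H1)) m)
    (f : J.domain) (g : H1) :
    Tendsto (fun M => ∑ k ∈ Finset.range M, conj (jacobiActRow n g k) * (f : H1) k) atTop
      (nhds ⟪g, J f⟫_ℂ) := by
  have hlim := (lp.hasSum_inner (𝕜 := ℂ) g (J f)).tendsto_sum_nat
  rw [← tendsto_add_atTop_iff_nat 1] at hlim ⊢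
  refine hlim.congr' ?_
  obtain ⟨B, hB⟩ := ((hdom f).1 f.2).bddAbove
  have hzero : ∀ m, B < m → (f : H1) m = 0 := fun m hm => by
    by_contra h
    exact absurd (hB h) (by omega)
  filter_upwards [eventually_gt_atTop B] with M hM
  have hW := sum_range_jacobiActRow n f g M
  rw [wronskian, hzero M hM, hzero (M + 1) (by omega), Finset.sum_sub_distrib] at hW
  simp only [zero_mul, sub_self, mul_zero, sub_eq_zero] at hW
  rw [hW]
  refine Finset.sum_congr rfl fun k _ => ?_
  rw [hact, RCLike.inner_apply, mul_comm]

theorem adjoint_apply_eq_jacobiActRow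
    (hdom : ∀ w : H1, w ∈ J.domain ↔ {m : ℕ | w m ≠ 0}.Finite)
    (hact : ∀ w : J.domain, ∀ m : ℕ, (J w : H1) m = jacobiActRow n (⇑(w : H1)) m)
    (g : J†.domain) (m : ℕ) : (J† g : H1) m = jacobiActRow n (g : H1) m := by
  have hJ := dense_domain_of_finite_support hdom
  have hlim := tendsto_sum_jacobiActRow hdom hact ⟨_, single_mem_domain hdom m 1⟩ g
  rw [← adjoint_isFormalAdjoint hJ g ⟨_, single_mem_domain hdom m 1⟩,
    lp.inner_single_right] at hlim
  have hev : Tendsto (fun M => ∑ k ∈ Finset.range M,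
      conj (jacobiActRow n (g : H1) k) * (lp.single 2 m 1 : H1) k) atTop
      (nhds (conj (jacobiActRow n (g : H1) m))) := by
    refine tendsto_const_nhds.congr' ?_
    filter_upwards [eventually_gt_atTop m] with M hM
    rw [Finset.sum_eq_single_of_mem m (Finset.mem_range.2 hM) fun k _ hk => by
      rw [lp.single_apply_ne 2 m 1 hk, mul_zero], lp.single_apply_self, mul_one]
  have := tendsto_nhds_unique hlim hev
  rw [RCLike.inner_apply, one_mul] at this
  exact (starRingEnd ℂ).injective this

theorem mem_adjoint_domain_of_jacobiActRow
    (hdom : ∀ w : H1, w ∈ J.domain ↔ {m : ℕ | w m ≠ 0}.Finite)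
    (hact : ∀ w : J.domain, ∀ m : ℕ, (J w : H1) m = jacobiActRow n (⇑(w : H1)) m)
    {g w : H1} (hw : ∀ m, w m = jacobiActRow n g m) : g ∈ J†.domain := by
  refine mem_adjoint_domain_of_exists _ ⟨w, fun f => ?_⟩
  refine tendsto_nhds_unique ?_ (tendsto_sum_jacobiActRow hdom hact f g)
  refine (lp.hasSum_inner (𝕜 := ℂ) w (f : H1)).tendsto_sum_nat.congr fun M => ?_
  refine Finset.sum_congr rfl fun k _ => ?_
  rw [hw, RCLike.inner_apply, mul_comm]

theorem le_adjoint_of_jacobiActRow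
    (hdom : ∀ w : H1, w ∈ J.domain ↔ {m : ℕ | w m ≠ 0}.Finite)
    (hact : ∀ w : J.domain, ∀ m : ℕ, (J w : H1) m = jacobiActRow n (⇑(w : H1)) m) :
    J ≤ J† := by
  refine ⟨fun f hf => mem_adjoint_domain_of_jacobiActRow hdom hact (hact ⟨f, hf⟩),
    fun x y hxy => lp.ext (funext fun m => ?_)⟩
  rw [hact, adjoint_apply_eq_jacobiActRow hdom hact, hxy]

theorem tendsto_wronskian
    (hdom : ∀ w : H1, w ∈ J.domain ↔ {m : ℕ | w m ≠ 0}.Finite)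
    (hact : ∀ w : J.domain, ∀ m : ℕ, (J w : H1) m = jacobiActRow n (⇑(w : H1)) m)
    (f g : J†.domain) :
    Tendsto (wronskian n (f : H1) (g : H1)) atTop (nhds (boundaryFunctional J g f)) := by
  have hlim := ((lp.hasSum_inner (𝕜 := ℂ) (J† g) (f : H1)).sub
    (lp.hasSum_inner (𝕜 := ℂ) (g : H1) (J† f))).tendsto_sum_nat
  rw [← tendsto_add_atTop_iff_nat 1] at hlim
  refine hlim.congr fun M => ?_
  rw [← sum_range_jacobiActRow]
  refine Finset.sum_congr rfl fun k _ => ?_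
  rw [adjoint_apply_eq_jacobiActRow hdom hact, adjoint_apply_eq_jacobiActRow hdom hact,
    RCLike.inner_apply, RCLike.inner_apply, mul_comm (conj _), mul_comm (conj _)]

theorem mem_adjoint_domain_of_recurrence (hn : 2 ≤ n)
    (hdom : ∀ w : H1, w ∈ J.domain ↔ {m : ℕ | w m ≠ 0}.Finite)
    (hact : ∀ w : J.domain, ∀ m : ℕ, (J w : H1) m = jacobiActRow n (⇑(w : H1)) m)
    {y : ℕ → ℝ}
    (hrec : ∀ m : ℕ, 1 ≤ m → beta (m - 1) n * y (m - 1) + beta m n * y (m + 1) = 0) :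
    ∃ w : J†.domain, ⇑(w : H1) = fun m => (y m : ℂ) := by
  let g : H1 := ⟨fun m => (y m : ℂ), memℓp_of_recurrence hn hrec⟩
  have hg : ∀ m, (lp.single 2 0 ((beta 0 n : ℂ) * y 1) : H1) m = jacobiActRow n g m := by
    intro m
    have hgm : ∀ k, g k = (y k : ℂ) := fun k => rfl
    obtain rfl | hm := Nat.eq_zero_or_pos m
    · rw [lp.single_apply_self]
      simp [jacobiActRow, hgm]
    · rw [lp.single_apply_ne 2 0 _ hm.ne']
      simp only [jacobiActRow, hgm, hm.ne', if_false]
      rw [add_comm]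
      exact_mod_cast (hrec m hm).symm
  exact ⟨⟨g, mem_adjoint_domain_of_jacobiActRow hdom hact hg⟩, rfl⟩

theorem isBoundaryPair_boundaryFunctional
    (hdom : ∀ w : H1, w ∈ J.domain ↔ {m : ℕ | w m ≠ 0}.Finite)
    (hact : ∀ w : J.domain, ∀ m : ℕ, (J w : H1) m = jacobiActRow n (⇑(w : H1)) m)
    {u v : ℕ → ℝ} {wu wv : J†.domain}
    (hu : ⇑(wu : H1) = fun m => (u m : ℂ)) (hv : ⇑(wv : H1) = fun m => (v m : ℂ))
    (huv : ∀ M, wronskian n (fun m => u m) (fun m => v m) M = 1) :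
    IsBoundaryPair J (boundaryFunctional J wv) (boundaryFunctional J wu) := by
  have hlim := tendsto_wronskian hdom hact
  have h₁ : boundaryFunctional J wv wu = 1 := by
    refine tendsto_nhds_unique (hlim wu wv) (tendsto_const_nhds.congr fun M => ?_)
    rw [hu, hv, huv]
  have h₂ : ∀ (y : ℕ → ℝ) (w : J†.domain), ⇑(w : H1) = (fun m => (y m : ℂ)) →
      boundaryFunctional J w w = 0 := by
    intro y w hw
    refine tendsto_nhds_unique (hlim w w) (tendsto_const_nhds.congr fun M => ?_)
    simp [hw, wronskian, mul_comm]
  have h₃ : boundaryFunctional J wu wv = -1 := by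
    refine tendsto_nhds_unique (hlim wv wu) (tendsto_const_nhds.congr fun M => ?_)
    rw [hu, hv, ← huv M]
    simp only [wronskian, Complex.conj_ofReal]
    ring
  refine ⟨fun f g => ?_, fun a b => ⟨a • wu - b • wv, ?_, ?_⟩⟩
  · have hfg : boundaryFunctional J g f =
        boundaryFunctional J wu f * conj (boundaryFunctional J wv g) -
          boundaryFunctional J wv f * conj (boundaryFunctional J wu g) := by
      refine tendsto_nhds_unique (hlim f g) ?_
      have hconj : ∀ w : J†.domain, Tendsto (fun M => conj (wronskian n (g : H1) (w : H1) M)) atTop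
          (nhds (conj (boundaryFunctional J w g))) := fun w =>
        (Complex.continuous_conj.tendsto _).comp (hlim g w)
      refine (((hlim f wu).mul (hconj wv)).sub ((hlim f wv).mul (hconj wu))).congr fun M => ?_
      rw [hu, hv, ← wronskian_plucker _ _ (huv M)]
    rw [boundaryFunctional_apply] at hfg
    linear_combination -hfg
  · simp [h₁, h₂ v wv hv]
  · simp [h₃, h₂ u wu hu]

end JacobiMatrix

/-- **Allahverdiev's classification of the self-adjoint extensions of `J_n`** (`n ≥ 2`):
with `Γ₁ f = [f,v]_∞` and `Γ₂ f = [f,u]_∞`, (i) for every `h ∈ ℝ` the restriction of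
`J_n*` to `{f ∈ D(J_n*) : Γ₁ f - h Γ₂ f = 0}` is self-adjoint, (ii) the restriction of
`J_n*` to `{f ∈ D(J_n*) : Γ₂ f = 0}` is self-adjoint, and (iii) every self-adjoint
extension of `J_n` is one of these operators. -/
theorem Jn_selfAdjoint_extensions_classification
    (n : ℕ) (hn : 2 ≤ n)
    (J : H1 →ₗ.[ℂ] H1)
    (hdom : ∀ w : H1, w ∈ J.domain ↔ {m : ℕ | w m ≠ 0}.Finite)
    (hact : ∀ w : J.domain, ∀ m : ℕ, (J w : H1) m = jacobiActRow n (⇑(w : H1)) m)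
    (u v : ℕ → ℝ)
    (hurec : ∀ m : ℕ, 1 ≤ m → beta (m - 1) n * u (m - 1) + beta m n * u (m + 1) = 0)
    (hu0 : u 0 = 1) (hu1 : u 1 = 0)
    (hvrec : ∀ m : ℕ, 1 ≤ m → beta (m - 1) n * v (m - 1) + beta m n * v (m + 1) = 0)
    (hv0 : v 0 = 0) (hv1 : v 1 = 1 / beta 0 n) :
    -- (i) the restriction of `J_n*` by the boundary condition `Γ₁ f - h Γ₂ f = 0`
    -- is self-adjoint
    (∀ (h : ℝ) (A : H1 →ₗ.[ℂ] H1),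
      (∀ f : H1, f ∈ A.domain ↔ (f ∈ J.adjoint.domain ∧
        ∃ L₁ L₂ : ℂ, Tendsto (brk n f v) atTop (nhds L₁) ∧
          Tendsto (brk n f u) atTop (nhds L₂) ∧ L₁ - (h : ℂ) * L₂ = 0)) →
      (∀ (f : H1) (hfA : f ∈ A.domain) (hfJ : f ∈ J.adjoint.domain),
        A ⟨f, hfA⟩ = J.adjoint ⟨f, hfJ⟩) →
      IsSelfAdjoint A) ∧
    -- (ii) the restriction of `J_n*` by the boundary condition `Γ₂ f = 0`
    -- is self-adjoint
    (∀ A : H1 →ₗ.[ℂ] H1,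
      (∀ f : H1, f ∈ A.domain ↔ (f ∈ J.adjoint.domain ∧
        Tendsto (brk n f u) atTop (nhds 0))) →
      (∀ (f : H1) (hfA : f ∈ A.domain) (hfJ : f ∈ J.adjoint.domain),
        A ⟨f, hfA⟩ = J.adjoint ⟨f, hfJ⟩) →
      IsSelfAdjoint A) ∧
    -- (iii) every self-adjoint extension of `J_n` is one of the operators above
    (∀ A : H1 →ₗ.[ℂ] H1, IsSelfAdjoint A → J ≤ A →
      ((∀ (f : H1) (hfA : f ∈ A.domain) (hfJ : f ∈ J.adjoint.domain),
          A ⟨f, hfA⟩ = J.adjoint ⟨f, hfJ⟩) ∧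
        ((∃ h : ℝ, ∀ f : H1, f ∈ A.domain ↔ (f ∈ J.adjoint.domain ∧
            ∃ L₁ L₂ : ℂ, Tendsto (brk n f v) atTop (nhds L₁) ∧
              Tendsto (brk n f u) atTop (nhds L₂) ∧ L₁ - (h : ℂ) * L₂ = 0)) ∨
          (∀ f : H1, f ∈ A.domain ↔ (f ∈ J.adjoint.domain ∧
            Tendsto (brk n f u) atTop (nhds 0)))))) := by
  have hJ := dense_domain_of_finite_support hdom
  have hJJ := le_adjoint_of_jacobiActRow hdom hact
  obtain ⟨wu, hwu⟩ := mem_adjoint_domain_of_recurrence hn hdom hact hurec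
  obtain ⟨wv, hwv⟩ := mem_adjoint_domain_of_recurrence hn hdom hact hvrec
  have hΓ := isBoundaryPair_boundaryFunctional hdom hact hwu hwv
    (wronskian_eq_one hn hurec hu0 hvrec hv0 hv1)
  have hbrk : ∀ (y : ℕ → ℝ) (w : J†.domain), ⇑(w : H1) = (fun m => (y m : ℂ)) →
      ∀ f : J†.domain, Tendsto (brk n f y) atTop (nhds (J.boundaryFunctional w f)) := by
    intro y w hw f
    have := tendsto_wronskian hdom hact f w
    rwa [hw] at this
  have hU := hbrk u wu hwu
  have hV := hbrk v wv hwv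
  have hiff₁ : ∀ (h : ℝ) (f : J†.domain), (∃ L₁ L₂ : ℂ, Tendsto (brk n f v) atTop (nhds L₁) ∧
      Tendsto (brk n f u) atTop (nhds L₂) ∧ L₁ - (h : ℂ) * L₂ = 0) ↔
      J.boundaryFunctional wv f = h * J.boundaryFunctional wu f := by
    refine fun h f => ⟨?_, fun hf => ⟨_, _, hV f, hU f, sub_eq_zero.2 hf⟩⟩
    rintro ⟨L₁, L₂, h₁, h₂, h₀⟩
    rw [tendsto_nhds_unique (hV f) h₁, tendsto_nhds_unique (hU f) h₂]
    exact sub_eq_zero.1 h₀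
  have hiff₂ : ∀ f : J†.domain, Tendsto (brk n f u) atTop (nhds 0) ↔
      J.boundaryFunctional wu f = 0 :=
    fun f => ⟨tendsto_nhds_unique (hU f), fun hf => hf ▸ hU f⟩
  have hle : ∀ A : H1 →ₗ.[ℂ] H1, A.domain ≤ J†.domain →
      (∀ (f : H1) (hfA : f ∈ A.domain) (hfJ : f ∈ J†.domain), A ⟨f, hfA⟩ = J† ⟨f, hfJ⟩) →
      A ≤ J† := by
    rintro A hA hval
    refine ⟨hA, ?_⟩
    rintro ⟨x, hx⟩ ⟨y, hy⟩ rfl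
    exact hval x hx hy
  refine ⟨fun h A hA hval => ?_, fun A hA hval => ?_, fun A hA hJA => ?_⟩
  · refine hΓ.isSelfAdjoint_of_boundary_eq hJ hJJ (hle A (fun f hf => ((hA f).1 hf).1) hval) h
      fun f => ?_
    rw [hA, ← hiff₁]
    exact and_iff_right f.2
  · refine hΓ.isSelfAdjoint_of_boundary_eq_zero hJ hJJ
      (hle A (fun f hf => ((hA f).1 hf).1) hval) fun f => ?_
    rw [hA, ← hiff₂]
    exact and_iff_right f.2
  · have hAJ := LinearPMap.le_adjoint_of_isSelfAdjoint hJ hA hJA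
    refine ⟨fun f hfA hfJ => hAJ.2 rfl, ?_⟩
    refine (hΓ.boundary_eq_of_isSelfAdjoint hJ hA hJA).imp ?_ ?_
    · rintro ⟨h, hh⟩
      refine ⟨h, fun f => ⟨fun hf => ⟨hAJ.1 hf, ?_⟩, fun ⟨hf, hL⟩ => ?_⟩⟩
      · exact (hiff₁ h ⟨f, hAJ.1 hf⟩).2 ((hh ⟨f, hAJ.1 hf⟩).1 hf)
      · exact (hh ⟨f, hf⟩).2 ((hiff₁ h ⟨f, hf⟩).1 hL)
    · intro hh f
      refine ⟨fun hf => ⟨hAJ.1 hf, ?_⟩, fun ⟨hf, hL⟩ => ?_⟩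
      · exact (hiff₂ ⟨f, hAJ.1 hf⟩).2 ((hh ⟨f, hAJ.1 hf⟩).1 hf)
      · exact (hh ⟨f, hf⟩).2 ((hiff₂ ⟨f, hf⟩).1 hL)
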